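/- arXiv:0708.1202 — 2 statements merged into one kernel-verified Lean document; each statement's English description precedes it below -/
import Mathlib

section
/- Let A, B, C be 2×2 complex matrices that are Hermitian (Aᴴ = A) and traceless. Then [[A,B],C] = ⟨B,C⟩·A − ⟨A,C⟩·B, where [X,Y] := YX − XY and ⟨X,Y⟩ := 2·tr(XY). -/
open Matrix

noncomputable section

/-- The Lie bracket `[X,Y] := YX − XY`. -/
def bracket (X Y : Matrix (Fin 2) (Fin 2) ℂ) : Matrix (Fin 2) (Fin 2) ℂ := Y * X - X * Y

/-- The trace form `⟨X,Y⟩ := 2·tr(XY)`. -/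
def traceForm (X Y : Matrix (Fin 2) (Fin 2) ℂ) : ℂ := 2 * (X * Y).trace

theorem apply_one_one_of_trace_eq_zero {R : Type*} [AddCommGroup R]
    {M : Matrix (Fin 2) (Fin 2) R} (hM : M.trace = 0) : M 1 1 = -M 0 0 :=
  eq_neg_of_add_eq_zero_right (by rwa [trace_fin_two] at hM)

theorem stmt_6 (A B C : Matrix (Fin 2) (Fin 2) ℂ)
    (hA : Aᴴ = A) (hB : Bᴴ = B) (hC : Cᴴ = C)
    (hA0 : A.trace = 0) (hB0 : B.trace = 0) (hC0 : C.trace = 0) :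
    bracket (bracket A B) C = traceForm B C • A - traceForm A C • B := by
  have hA1 := apply_one_one_of_trace_eq_zero hA0
  have hB1 := apply_one_one_of_trace_eq_zero hB0
  have hC1 := apply_one_one_of_trace_eq_zero hC0
  ext i j
  fin_cases i <;> fin_cases j <;>
    simp [bracket, traceForm, trace_fin_two, mul_apply, Fin.sum_univ_two, hA1, hB1, hC1] <;>
    ring
end
end

section
/- Let A be a traceless skew-Hermitian 2×2 complex matrix and B a traceless Hermitian 2×2 complex matrix. Then [[A,B],B] = ⟨B,B⟩·A − ⟨A,B⟩·B, where [X,Y] := YX − XY and ⟨X,Y⟩ := 2·tr(XY) (a complex-valued pairing). -/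
open Matrix

noncomputable section

theorem stmt_7 (A B : Matrix (Fin 2) (Fin 2) ℂ)
    (hA : Aᴴ = -A) (hB : Bᴴ = B)
    (hA0 : A.trace = 0) (hB0 : B.trace = 0) :
    bracket (bracket A B) B = traceForm B B • A - traceForm A B • B := by
  have hA1 : A 1 1 = -A 0 0 := by
    rw [trace_fin_two] at hA0
    linear_combination hA0
  have hB1 : B 1 1 = -B 0 0 := by
    rw [trace_fin_two] at hB0
    linear_combination hB0
  ext i j
  fin_cases i <;> fin_cases j <;>
    simp [bracket, traceForm, trace_fin_two, mul_apply, Fin.sum_univ_two, hA1, hB1] <;> ring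
end
end
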